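/- arXiv:2403.19860 — 2 statements merged into one kernel-verified Lean document; each statement's English description precedes it below -/
import Mathlib

section
/- Let σ² > 0, and let μ be a probability measure on ℝ with mean 0 and variance σ². Then μ° = μ if and only if μ is the semicircle law of mean 0 and variance σ², i.e., the measure on ℝ with density x ↦ (1/(2πσ²))·√(max(4σ² − x², 0)) with respect to Lebesgue measure. In other words, the semicircle law is the unique fixed point of the free zero bias transformation on measures with mean 0 and variance σ². -/
open MeasureTheory Complex

/-- The Cauchy transform of a measure on ℝ. -/
noncomputable def cauchy (μ : Measure ℝ) (z : ℂ) : ℂ := ∫ t, (z - (t : ℂ))⁻¹ ∂μ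

/-- The semicircle law of mean 0 and variance σ², with density
x ↦ (1/(2πσ²))·√(max(4σ² − x², 0)) with respect to Lebesgue measure. -/
noncomputable def semicircle (σ2 : ℝ) : Measure ℝ :=
  volume.withDensity fun x =>
    ENNReal.ofReal ((2 * Real.pi * σ2)⁻¹ * Real.sqrt (max (4 * σ2 - x ^ 2) 0))

open Filter Topology in
lemma aux_tendsto (μ : Measure ℝ) [IsFiniteMeasure μ] (f : ℝ → ℝ) (hf : Continuous f)
    (C : ℝ) (hC : ∀ x, ‖f x‖ ≤ C) :
    Tendsto (fun y : ℝ => ∫ t, (∫ u : ℝ, f (t + y * u) * (1 + u ^ 2)⁻¹) ∂μ) (𝓝[>] 0)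
      (𝓝 (∫ t, f t * Real.pi ∂μ)) := by
  have hb : ∀ x u : ℝ, ‖f x * (1 + u ^ 2)⁻¹‖ ≤ C * (1 + u ^ 2)⁻¹ := by
    intro x u
    rw [norm_mul, Real.norm_of_nonneg (by positivity : (0 : ℝ) ≤ (1 + u ^ 2)⁻¹)]
    exact mul_le_mul_of_nonneg_right (hC x) (by positivity)
  have hI : Integrable (fun u : ℝ => C * (1 + u ^ 2)⁻¹) := integrable_inv_one_add_sq.const_mul C
  have hcont : Continuous fun u : ℝ => (1 + u ^ 2)⁻¹ :=
    Continuous.inv₀ (by fun_prop) (fun u => by positivity)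
  apply tendsto_integral_filter_of_dominated_convergence (fun _ => C * Real.pi)
  · refine Eventually.of_forall fun y => ?_
    apply Continuous.aestronglyMeasurable
    apply continuous_of_dominated (bound := fun u => C * (1 + u ^ 2)⁻¹)
    · intro t
      exact Continuous.aestronglyMeasurable (by fun_prop)
    · intro t
      exact Eventually.of_forall fun u => hb _ _
    · exact hI
    · exact Eventually.of_forall fun u => by fun_prop
  · refine Eventually.of_forall fun y => Eventually.of_forall fun t => ?_
    have := norm_integral_le_of_norm_le hI
      (Eventually.of_forall fun u => hb (t + y * u) u)
    rwa [integral_const_mul, integral_univ_inv_one_add_sq] at this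
  · exact integrable_const _
  · refine Eventually.of_forall fun t => ?_
    rw [← integral_univ_inv_one_add_sq, ← integral_const_mul]
    apply tendsto_integral_filter_of_dominated_convergence (fun u => C * (1 + u ^ 2)⁻¹)
    · exact Eventually.of_forall fun y => Continuous.aestronglyMeasurable (by fun_prop)
    · exact Eventually.of_forall fun y => Eventually.of_forall fun u => hb _ _
    · exact hI
    · refine Eventually.of_forall fun u => ?_
      have h : Continuous fun y : ℝ => f (t + y * u) * (1 + u ^ 2)⁻¹ := by fun_prop
      have := h.tendsto 0
      simp only [zero_mul, add_zero] at this
      exact this.mono_left nhdsWithin_le_nhds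

lemma aux_ne (z : ℂ) (hz : 0 < z.im) (t : ℝ) : z - (t : ℂ) ≠ 0 := by
  intro h
  have := congrArg Complex.im h
  simp at this
  linarith

lemma aux_cont (z : ℂ) (hz : 0 < z.im) : Continuous fun t : ℝ => (z - (t : ℂ))⁻¹ :=
  Continuous.inv₀ (by fun_prop) (aux_ne z hz)

lemma aux_norm (z : ℂ) (hz : 0 < z.im) (t : ℝ) : ‖(z - (t : ℂ))⁻¹‖ ≤ z.im⁻¹ := by
  rw [norm_inv]
  apply inv_anti₀ hz
  have := Complex.abs_im_le_norm (z - (t : ℂ))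
  simp only [sub_im, ofReal_im, sub_zero] at this
  exact (le_abs_self _).trans this

lemma aux_int (μ : Measure ℝ) [IsFiniteMeasure μ] (z : ℂ) (hz : 0 < z.im) :
    Integrable (fun t : ℝ => (z - (t : ℂ))⁻¹) μ :=
  Integrable.of_bound (aux_cont z hz).aestronglyMeasurable z.im⁻¹
    (Filter.Eventually.of_forall (aux_norm z hz))

lemma cauchy_im (μ : Measure ℝ) [IsFiniteMeasure μ] (z : ℂ) (hz : 0 < z.im) :
    (cauchy μ z).im = ∫ t, ((z - (t : ℂ))⁻¹).im ∂μ := by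
  unfold cauchy
  have := integral_im (aux_int μ z hz)
  exact this.symm

lemma cauchy_im_nonpos (μ : Measure ℝ) [IsFiniteMeasure μ] (z : ℂ) (hz : 0 < z.im) :
    (cauchy μ z).im ≤ 0 := by
  rw [cauchy_im μ z hz]
  apply integral_nonpos
  intro t
  simp only [Complex.inv_im, sub_im, ofReal_im, sub_zero, Pi.zero_apply]
  exact div_nonpos_of_nonpos_of_nonneg (by linarith) (Complex.normSq_nonneg _)

lemma aux_fubini (μ : Measure ℝ) [IsFiniteMeasure μ] (f : ℝ → ℝ) (hf : Continuous f)
    (hi : Integrable f) (y : ℝ) (hy : 0 < y) :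
    ∫ t, (∫ u : ℝ, f (t + y * u) * (1 + u ^ 2)⁻¹) ∂μ =
      - ∫ x : ℝ, f x * (cauchy μ (x + y * I)).im := by
  have him : ∀ x : ℝ, 0 < ((x : ℂ) + y * I).im := by intro x; simpa using hy
  have hk : ∀ x t : ℝ, (((x : ℂ) + y * I - (t : ℂ))⁻¹).im = - (y / ((x - t) ^ 2 + y ^ 2)) := by
    intro x t
    simp [Complex.inv_im, Complex.normSq_apply, neg_div, pow_two]
  have hd : ∀ x t : ℝ, 0 < (x - t) ^ 2 + y ^ 2 := fun x t => by positivity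
  have h1 : ∀ x : ℝ, - (f x * (cauchy μ (x + y * I)).im) =
      ∫ t, f x * (y / ((x - t) ^ 2 + y ^ 2)) ∂μ := by
    intro x
    rw [cauchy_im μ _ (him x), integral_const_mul, ← mul_neg, ← integral_neg]
    simp only [hk, neg_neg]
  rw [← integral_neg]
  simp only [h1]
  symm
  rw [integral_integral_swap]
  · congr 1
    ext t
    rw [← integral_add_left_eq_self t (μ := volume) (f := fun x => f x * (y / ((x - t) ^ 2 + y ^ 2)))]
    have := Measure.integral_comp_mul_left (fun v => f (t + v) * (y / ((t + v - t) ^ 2 + y ^ 2))) y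
    rw [abs_of_pos (inv_pos.2 hy), smul_eq_mul] at this
    have h3 : ∫ v, f (t + v) * (y / ((t + v - t) ^ 2 + y ^ 2)) =
      y * ∫ u, f (t + y * u) * (y / ((t + y * u - t) ^ 2 + y ^ 2)) := by
      rw [this, mul_inv_cancel_left₀ hy.ne']
    rw [h3, ← integral_const_mul]
    congr 1
    ext u
    have : (t + y * u - t) ^ 2 + y ^ 2 = y ^ 2 * (1 + u ^ 2) := by ring
    rw [this]
    have : (1 + u ^ 2) ≠ 0 := by positivity
    field_simp
  · have hc : Continuous fun p : ℝ × ℝ => y / ((p.1 - p.2) ^ 2 + y ^ 2) :=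
      Continuous.div (by fun_prop) (by fun_prop) (fun p => (hd _ _).ne')
    have h2 : Integrable (fun p : ℝ × ℝ => f p.1) (volume.prod μ) := hi.comp_fst μ
    refine h2.mul_bdd (c := y⁻¹) hc.aestronglyMeasurable (Filter.Eventually.of_forall fun p => ?_)
    have := hd p.1 p.2
    rw [Real.norm_of_nonneg (by positivity), div_le_iff₀ this]
    have : y⁻¹ * y ^ 2 = y := by field_simp
    have h4 : 0 ≤ y⁻¹ * (p.1 - p.2) ^ 2 := by positivity
    linarith

open Filter Topology in
lemma cauchy_inj (μ ν : Measure ℝ) [IsFiniteMeasure μ] [IsFiniteMeasure ν]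
    (h : ∀ z : ℂ, 0 < z.im → cauchy μ z = cauchy ν z) : μ = ν := by
  apply Measure.ext_of_integral_eq_on_compactlySupported
  intro f
  obtain ⟨C, hC⟩ := f.continuous.bounded_above_of_compact_support f.hasCompactSupport
  have a := aux_tendsto μ f f.continuous C hC
  have b := aux_tendsto ν f f.continuous C hC
  have e : (fun y : ℝ => ∫ t, (∫ u : ℝ, f (t + y * u) * (1 + u ^ 2)⁻¹) ∂μ) =ᶠ[𝓝[>] 0]
      (fun y : ℝ => ∫ t, (∫ u : ℝ, f (t + y * u) * (1 + u ^ 2)⁻¹) ∂ν) := by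
    filter_upwards [self_mem_nhdsWithin] with y hy
    have hi : Integrable f := f.continuous.integrable_of_hasCompactSupport f.hasCompactSupport
    rw [aux_fubini μ f f.continuous hi y hy, aux_fubini ν f f.continuous hi y hy]
    congr 2
    ext x
    rw [h _ (by simpa using hy)]
  have := tendsto_nhds_unique a (b.congr' e.symm)
  rw [integral_mul_const, integral_mul_const] at this
  exact mul_right_cancel₀ Real.pi_ne_zero this

lemma exists_w (s : ℝ) (hs : 0 < s) (z : ℂ) (hz : 0 < z.im) :
    ∃ w : ℂ, w ≠ 0 ∧ ‖w‖ < 1 ∧ z * w = s * (w ^ 2 + 1) := by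
  have hs' : (s : ℂ) ≠ 0 := by exact_mod_cast hs.ne'
  obtain ⟨d, hd⟩ := IsAlgClosed.exists_pow_nat_eq (z ^ 2 - 4 * s ^ 2) (n := 2) (by norm_num)
  have key : ∃ w : ℂ, z * w = s * (w ^ 2 + 1) := by
    refine ⟨(z + d) / (2 * s), ?_⟩
    field_simp
    linear_combination -hd
  obtain ⟨w, hw⟩ := key
  have h0 : w ≠ 0 := by
    rintro rfl
    simp at hw
    exact hs.ne' (by exact_mod_cast hw.symm)
  have h1 : ‖w‖ ≠ 1 := by
    intro h
    have h2 : w⁻¹ = (starRingEnd ℂ) w := by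
      rw [Complex.inv_def, Complex.normSq_eq_norm_sq, h]; simp
    have h3 : z = s * (w + w⁻¹) := by field_simp; linear_combination hw
    rw [h2, Complex.add_conj] at h3
    rw [h3] at hz
    simp at hz
  rcases lt_or_gt_of_ne h1 with h | h
  · exact ⟨w, h0, h, hw⟩
  · refine ⟨w⁻¹, inv_ne_zero h0, ?_, ?_⟩
    · rw [norm_inv]; exact inv_lt_one_of_one_lt₀ h
    · field_simp; linear_combination hw

lemma ne_of_small (w ζ : ℂ) (hw : ‖w‖ < 1) (hζ : ‖ζ‖ ≤ 1) : 1 - w * ζ ≠ 0 := by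
  intro h
  have h1 : w * ζ = 1 := by linear_combination -h
  have h2 : ‖w‖ * ‖ζ‖ = 1 := by rw [← norm_mul, h1, norm_one]
  nlinarith [norm_nonneg w, norm_nonneg ζ]

lemma aux_circ (w : ℂ) (hw : ‖w‖ < 1) :
    ∫ θ in (0 : ℝ)..2 * Real.pi, (fun ζ : ℂ => (ζ ^ 2 - 1) / (1 - w * ζ)) (circleMap 0 1 θ)
      = - (2 * (Real.pi : ℂ)) := by
  have hd : DiffContOnCl ℂ (fun ζ : ℂ => (ζ ^ 2 - 1) / (1 - w * ζ)) (Metric.ball 0 |1|) := by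
    apply DifferentiableOn.diffContOnCl
    rw [abs_one, closure_ball _ one_ne_zero]
    intro ζ hζ
    apply DifferentiableAt.differentiableWithinAt
    have : 1 - w * ζ ≠ 0 := ne_of_small w ζ hw (by simpa using hζ)
    fun_prop (disch := assumption)
  have := hd.circleAverage
  rw [Real.circleAverage_def] at this
  rw [Complex.real_smul] at this
  push_cast at this
  rw [inv_mul_eq_iff_eq_mul₀ (by simp)] at this
  rw [this]
  simp

lemma aux_trig (w : ℂ) (hw : ‖w‖ < 1) :
    ∫ θ in (0 : ℝ)..Real.pi, ((Real.sin θ : ℂ) ^ 2) / (1 - 2 * w * Real.cos θ + w ^ 2)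
      = (Real.pi : ℂ) / 2 := by
  set A : ℝ → ℂ := fun θ => (fun ζ : ℂ => (ζ ^ 2 - 1) / (1 - w * ζ)) (circleMap 0 1 θ) with hA
  have hne : ∀ θ, 1 - w * circleMap 0 1 θ ≠ 0 := fun θ => ne_of_small w _ hw (by simp)
  have hcA : Continuous A := by
    have := continuous_circleMap 0 1
    exact Continuous.div (by fun_prop) (by fun_prop) hne
  have hF : ∀ θ : ℝ, ((Real.sin θ : ℂ) ^ 2) / (1 - 2 * w * Real.cos θ + w ^ 2) =
      -(1 / 4) * (A θ + A (-θ)) := by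
    intro θ
    have h1 := hne θ
    have h2 := hne (-θ)
    have e1 : circleMap 0 1 θ = cos θ + sin θ * I := by
      simp [circleMap, Complex.exp_mul_I]
    have e2 : circleMap 0 1 (-θ) = cos θ - sin θ * I := by
      simp [circleMap, ← neg_mul, Complex.exp_mul_I, sub_eq_add_neg]
    simp only [hA]
    rw [e1] at h1 ⊢
    rw [e2] at h2 ⊢
    push_cast
    have hsc := Complex.sin_sq_add_cos_sq θ
    have hI := Complex.I_sq
    generalize Complex.sin θ = S at *
    generalize Complex.cos θ = K at *
    have hden : 1 - 2 * w * K + w ^ 2 = (1 - w * (K + S * I)) * (1 - w * (K - S * I)) := by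
      linear_combination (-w^2) * hsc + w^2*S^2 * hI
    have hab : (K + S * I) * (K - S * I) = 1 := by
      linear_combination hsc - S ^ 2 * hI
    have hS : S ^ 2 = -((K + S * I) - (K - S * I)) ^ 2 / 4 := by
      linear_combination S ^ 2 * hI
    rw [hden, hS]
    generalize K + S * I = a at *
    generalize K - S * I = b at *
    rw [div_add_div _ _ h1 h2, ← mul_div_assoc, div_left_inj' (mul_ne_zero h1 h2)]
    linear_combination (1 / 2 - w * (a + b) / 4) * hab
  simp only [hF]
  have hcA' : Continuous fun θ => A (-θ) := hcA.comp continuous_neg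
  rw [intervalIntegral.integral_const_mul, intervalIntegral.integral_add
    (hcA.intervalIntegrable _ _) (hcA'.intervalIntegrable _ _),
    intervalIntegral.integral_comp_neg, neg_zero, add_comm,
    intervalIntegral.integral_add_adjacent_intervals
    (hcA.intervalIntegrable _ _) (hcA.intervalIntegrable _ _)]
  have hper : Function.Periodic A (2 * Real.pi) := by
    intro θ
    simp only [hA, periodic_circleMap 0 1 θ]
  have := hper.intervalIntegral_add_eq (-Real.pi) 0
  rw [show -Real.pi + 2 * Real.pi = Real.pi by ring, zero_add, aux_circ w hw] at this
  rw [this]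
  ring

lemma semicircle_dens_cont (σ2 : ℝ) : Continuous fun x : ℝ =>
    (2 * Real.pi * σ2)⁻¹ * Real.sqrt (max (4 * σ2 - x ^ 2) 0) := by fun_prop

lemma semicircle_zero (s x : ℝ) (hs : 0 < s) (hx : x ∉ Set.Ioc (-(2 * s)) (2 * s)) :
    Real.sqrt (max (4 * s ^ 2 - x ^ 2) 0) = 0 := by
  rw [max_eq_right, Real.sqrt_zero]
  by_contra! h
  have : |x| < 2 * s := by
    apply abs_lt_of_sq_lt_sq _ (by positivity)
    linarith
  rw [abs_lt] at this
  exact hx ⟨this.1, this.2.le⟩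

lemma semicircle_finite (s : ℝ) (hs : 0 < s) : IsFiniteMeasure (semicircle (s ^ 2)) := by
  apply isFiniteMeasure_withDensity_ofReal
  apply Integrable.hasFiniteIntegral
  apply (semicircle_dens_cont (s ^ 2)).integrable_of_hasCompactSupport
  apply HasCompactSupport.intro (isCompact_Icc (a := -(2 * s)) (b := 2 * s))
  intro x hx
  rw [semicircle_zero s x hs (fun h => hx ⟨h.1.le, h.2⟩), mul_zero]

lemma cauchy_semicircle (s : ℝ) (hs : 0 < s) (z : ℂ) (hz : 0 < z.im) (w : ℂ) (h0 : w ≠ 0)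
    (hw : ‖w‖ < 1) (h : z * w = s * (w ^ 2 + 1)) : cauchy (semicircle (s ^ 2)) z = w / s := by
  have hs' : (s : ℂ) ≠ 0 := by exact_mod_cast hs.ne'
  have hp : (Real.pi : ℂ) ≠ 0 := by exact_mod_cast Real.pi_ne_zero
  unfold cauchy semicircle
  rw [integral_withDensity_eq_integral_toReal_smul
    (semicircle_dens_cont (s ^ 2)).measurable.ennreal_ofReal
    (Filter.Eventually.of_forall fun x => ENNReal.ofReal_lt_top)]
  set g : ℝ → ℂ := fun x => ((2 * Real.pi * s ^ 2)⁻¹ * Real.sqrt (max (4 * s ^ 2 - x ^ 2) 0)) •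
    (z - (x : ℂ))⁻¹ with hg
  have hgc : Continuous g := (semicircle_dens_cont (s ^ 2)).smul (aux_cont z hz)
  have e1 : ∀ x : ℝ, (ENNReal.ofReal ((2 * Real.pi * s ^ 2)⁻¹ *
      Real.sqrt (max (4 * s ^ 2 - x ^ 2) 0))).toReal • (z - (x : ℂ))⁻¹ = g x := by
    intro x
    rw [ENNReal.toReal_ofReal (by positivity)]
  simp only [e1]
  rw [← setIntegral_eq_integral_of_forall_compl_eq_zero (s := Set.Ioc (-(2 * s)) (2 * s))
    (fun x hx => by simp only [hg]; rw [semicircle_zero s x hs hx, mul_zero, zero_smul]),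
    ← intervalIntegral.integral_of_le (by linarith)]
  have hsub := intervalIntegral.integral_deriv_smul_comp (a := Real.pi) (b := 0)
    (f := fun θ => 2 * s * Real.cos θ) (f' := fun θ => 2 * s * (-Real.sin θ)) (g := g)
    (fun θ _ => (Real.hasDerivAt_cos θ).const_mul (2 * s)) (by fun_prop) hgc
  rw [Real.cos_pi, Real.cos_zero, mul_neg_one, mul_one] at hsub
  rw [← hsub, intervalIntegral.integral_symm, ← intervalIntegral.integral_neg]
  have e2 : ∀ θ ∈ Set.uIcc 0 Real.pi, -((2 * s * (-Real.sin θ)) •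
      (g ∘ fun θ => 2 * s * Real.cos θ) θ) = (2 * w / (Real.pi * s)) *
      (((Real.sin θ : ℂ) ^ 2) / (1 - 2 * w * Real.cos θ + w ^ 2)) := by
    intro θ hθ
    rw [Set.uIcc_of_le Real.pi_pos.le] at hθ
    have hsin : 0 ≤ Real.sin θ := Real.sin_nonneg_of_mem_Icc hθ
    have hsq : Real.sqrt (max (4 * s ^ 2 - (2 * s * Real.cos θ) ^ 2) 0) = 2 * s * Real.sin θ := by
      have : 4 * s ^ 2 - (2 * s * Real.cos θ) ^ 2 = (2 * s * Real.sin θ) ^ 2 := by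
        rw [mul_pow, mul_pow, mul_pow _ (Real.sin θ), Real.sin_sq]; ring
      rw [this, max_eq_left (by positivity), Real.sqrt_sq (by positivity)]
    have hne := aux_ne z hz (2 * s * Real.cos θ)
    simp only [hg, Function.comp, hsq, Complex.real_smul]
    have hz' : z = s * (w ^ 2 + 1) / w := by rw [eq_div_iff h0, h]
    have hden : z - ((2 * s * Real.cos θ : ℝ) : ℂ) =
        s * (1 - 2 * w * Real.cos θ + w ^ 2) / w := by
      rw [hz']; push_cast; field_simp; ring
    rw [hden] at hne ⊢
    have hd : 1 - 2 * w * (Real.cos θ : ℂ) + w ^ 2 ≠ 0 := by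
      intro h'
      rw [h'] at hne; simp at hne
    generalize (1 - 2 * w * (Real.cos θ : ℂ) + w ^ 2) = D at *
    push_cast
    field_simp
  rw [intervalIntegral.integral_congr e2, intervalIntegral.integral_const_mul, aux_trig w hw]
  field_simp

lemma quad_unique (σ2 : ℝ) (hσ : 0 < σ2) (z a b : ℂ) (hz : 0 < z.im) (ha : a.im ≤ 0)
    (hb : b.im ≤ 0) (h1 : a ^ 2 = (z * a - 1) / σ2) (h2 : b ^ 2 = (z * b - 1) / σ2) : a = b := by
  have hs : (σ2 : ℂ) ≠ 0 := by exact_mod_cast hσ.ne'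
  rw [eq_div_iff hs] at h1 h2
  by_contra hne
  have : (a - b) * ((a + b) * σ2 - z) = 0 := by linear_combination h1 - h2
  rcases mul_eq_zero.1 this with h | h
  · exact hne (sub_eq_zero.1 h)
  · have := congrArg Complex.im h
    simp at this
    nlinarith

/-- for μ with mean 0 and variance σ² > 0, one has μ° = μ (i.e. μ itself
satisfies the defining equation of the free zero bias) iff μ is the semicircle law of
mean 0 and variance σ². -/
theorem semicircle_unique_fixed_point (σ2 : ℝ) (hσ : 0 < σ2)
    (μ : Measure ℝ) [IsProbabilityMeasure μ]
    (h1 : Integrable (fun t => t) μ) (hmean : (∫ t, t ∂μ) = 0)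
    (h2 : Integrable (fun t => t ^ 2) μ) (hvar : (∫ t, t ^ 2 ∂μ) = σ2) :
    (∀ z : ℂ, 0 < z.im → (cauchy μ z) ^ 2 = (z * cauchy μ z - 1) / (σ2 : ℂ)) ↔
      μ = semicircle σ2 := by
  obtain ⟨s, hs, rfl⟩ : ∃ s : ℝ, 0 < s ∧ σ2 = s ^ 2 :=
    ⟨Real.sqrt σ2, Real.sqrt_pos.2 hσ, (Real.sq_sqrt hσ.le).symm⟩
  have hs' : (s : ℂ) ≠ 0 := by exact_mod_cast hs.ne'
  haveI := semicircle_finite s hs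
  have key : ∀ z : ℂ, 0 < z.im → (cauchy (semicircle (s ^ 2)) z) ^ 2 =
      (z * cauchy (semicircle (s ^ 2)) z - 1) / ((s ^ 2 : ℝ) : ℂ) := by
    intro z hz
    obtain ⟨w, h0, hw, h⟩ := exists_w s hs z hz
    rw [cauchy_semicircle s hs z hz w h0 hw h]
    push_cast
    field_simp
    linear_combination -h
  constructor
  · intro h
    apply cauchy_inj
    intro z hz
    exact quad_unique (s ^ 2) hσ z _ _ hz (cauchy_im_nonpos μ z hz)
      (cauchy_im_nonpos _ z hz) (h z hz) (key z hz)
  · rintro rfl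
    exact key
end

section
/- Let μ be a probability measure on ℝ with mean 0 and variance σ² ∈ (0,∞), and let ν be any probability measure on ℝ. Then the following are equivalent: (a) for all w ∈ ℂ₊, G_{μ°}(w) = G_{ν^♭}(1/G_μ(w)) (note 1/G_μ(w) ∈ ℂ₊ since Im G_μ(w) < 0, so the right side is defined); (b) for all w ∈ ℂ₊, w·G_μ(w) − 1 = σ² · G_μ(w) · G_ν(1/G_μ(w)). (Relation (a) is the reciprocal-Cauchy-transform relation F_{μ°} = F_{ν^♭} ∘ F_μ on ℂ₊, where F = 1/G, and relation (b) is the free Lévy–Khintchine relation φ_μ = σ²·G_ν expressed through Cauchy transforms; ν is then the Lévy measure of μ.) -/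
open MeasureTheory Complex

theorem cauchy_im_neg (μ : Measure ℝ) [IsProbabilityMeasure μ] (z : ℂ) (hz : 0 < z.im) :
    (cauchy μ z).im < 0 := by
  have hne : ∀ t : ℝ, z - (t : ℂ) ≠ 0 := by
    intro t h
    have := congrArg Complex.im h
    simp at this
    exact hz.ne' this
  have hint : Integrable (fun t : ℝ => (z - (t : ℂ))⁻¹) μ := by
    refine Integrable.of_bound (C := z.im⁻¹) ?_ ?_
    · apply Measurable.aestronglyMeasurable
      fun_prop
    · refine Filter.Eventually.of_forall fun t => ?_
      rw [norm_inv]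
      apply inv_anti₀ hz
      have := Complex.abs_im_le_norm (z - (t : ℂ))
      simp only [sub_im, ofReal_im, sub_zero] at this
      exact (le_abs_self _).trans this
  have him : (cauchy μ z).im = ∫ t : ℝ, ((z - (t : ℂ))⁻¹).im ∂μ := by
    have := integral_im (𝕜 := ℂ) hint
    exact this.symm
  have hval : ∀ t : ℝ, 0 < -((z - (t : ℂ))⁻¹).im := by
    intro t
    rw [Complex.inv_im]
    have h : 0 < Complex.normSq (z - (t : ℂ)) := Complex.normSq_pos.2 (hne t)
    simp only [sub_im, ofReal_im, sub_zero, neg_div, neg_neg]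
    positivity
  have hp : 0 < ∫ t : ℝ, -((z - (t : ℂ))⁻¹).im ∂μ := by
    rw [integral_pos_iff_support_of_nonneg (fun t => (hval t).le) (Integrable.neg hint.im)]
    have : Function.support (fun t : ℝ => -((z - (t : ℂ))⁻¹).im) = Set.univ :=
      Set.eq_univ_of_forall fun t => (hval t).ne'
    rw [this]
    simp
  rw [integral_neg] at hp
  linarith

/-- for μ with mean 0 and variance σ² ∈ (0,∞), ν any probability measure,
ρ° = μ° the free zero bias of μ and ρ♭ = ν^♭ the El Gordo transform of ν (each
characterized by its defining equation), the following are equivalent: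
(a) G_{μ°}(w) = G_{ν^♭}(1/G_μ(w)) for all w ∈ ℂ₊;
(b) w·G_μ(w) − 1 = σ²·G_μ(w)·G_ν(1/G_μ(w)) for all w ∈ ℂ₊. -/
theorem free_LevyKhintchine_equivalence (μ ν ρc ρb : Measure ℝ)
    [IsProbabilityMeasure μ] [IsProbabilityMeasure ν]
    [IsProbabilityMeasure ρc] [IsProbabilityMeasure ρb]
    (h1 : Integrable (fun t => t) μ) (hmean : (∫ t, t ∂μ) = 0)
    (h2 : Integrable (fun t => t ^ 2) μ) (hpos : 0 < ∫ t, t ^ 2 ∂μ)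
    (hρc : ∀ z : ℂ, 0 < z.im →
      (cauchy ρc z) ^ 2 = (z * cauchy μ z - 1) / ((∫ t, t ^ 2 ∂μ : ℝ) : ℂ))
    (hρb : ∀ z : ℂ, 0 < z.im → (cauchy ρb z) ^ 2 = cauchy ν z / z) :
    (∀ w : ℂ, 0 < w.im → cauchy ρc w = cauchy ρb (cauchy μ w)⁻¹) ↔
    (∀ w : ℂ, 0 < w.im →
      w * cauchy μ w - 1
        = ((∫ t, t ^ 2 ∂μ : ℝ) : ℂ) * cauchy μ w * cauchy ν (cauchy μ w)⁻¹) := by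
  have hs : ((∫ t, t ^ 2 ∂μ : ℝ) : ℂ) ≠ 0 := by exact_mod_cast hpos.ne'
  have hG : ∀ w : ℂ, 0 < w.im → cauchy μ w ≠ 0 := by
    intro w hw h
    have := cauchy_im_neg μ w hw
    simp [h] at this
  have hF : ∀ w : ℂ, 0 < w.im → 0 < ((cauchy μ w)⁻¹).im := by
    intro w hw
    rw [Complex.inv_im]
    exact div_pos (neg_pos.2 (cauchy_im_neg μ w hw)) (Complex.normSq_pos.2 (hG w hw))
  generalize ((∫ t, t ^ 2 ∂μ : ℝ) : ℂ) = s at *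
  constructor
  · intro h w hw
    have e := hρc w hw
    rw [h w hw, hρb _ (hF w hw), div_inv_eq_mul, eq_div_iff hs] at e
    rw [← e]
    ring
  · intro h w hw
    have e : cauchy ρc w ^ 2 = cauchy ρb (cauchy μ w)⁻¹ ^ 2 := by
      rw [hρc w hw, hρb _ (hF w hw), h w hw, div_inv_eq_mul, div_eq_iff hs]
      ring
    rcases sq_eq_sq_iff_eq_or_eq_neg.1 e with e | e
    · exact e
    · have a := cauchy_im_neg ρc w hw
      have b := cauchy_im_neg ρb _ (hF w hw)
      rw [e, Complex.neg_im] at a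
      linarith
end
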